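/- Let A be a real m×n matrix with no zero block, B a real m×p matrix, I≤ and I= disjoint sets of row indices with I≤ ∪ I= = {1,…,m}, and suppose the feasible region Ω = {X ∈ ℝ^{n×p} : (AX)_{ij} ≤ B_{ij} for all i ∈ I≤ and all j, and (AX)_{ij} = B_{ij} for all i ∈ I= and all j} is nonempty. Let T be a partition of I≤ into blocks and T' a partition of I= into blocks, with ‖A_τ‖_F > 0 for every block τ ∈ T ∪ T'. Assign to each block τ a step size t_τ with 0 < t_τ < 2 and probability p_τ = ‖A_τ‖_F²/‖A‖_F². Suppose L > 0 satisfies d(X,Ω) ≤ L·‖c_M(AX − B)‖_F for all X ∈ ℝ^{n×p}. For X ∈ ℝ^{n×p} and a block τ, define the B-MRK update X_τ⁺ = X − (t_τ/‖A_τ‖_F²)·A_τᵀ(A_τX − B_τ)_+ if τ ∈ T, and X_τ⁺ = X − (t_τ/‖A_τ‖_F²)·A_τᵀ(A_τX − B_τ) if τ ∈ T'. Then Σ_{τ ∈ T∪T'} p_τ · d(X_τ⁺, Ω)² ≤ (1 − (min_{τ ∈ T∪T'} 2t_τ(1 − t_τ/2))/(L²‖A‖_F²)) · d(X, Ω)².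 -/

import Mathlib

open Finset

/-- Frobenius norm of a real matrix. -/
noncomputable def frob {a b : ℕ} (M : Matrix (Fin a) (Fin b) ℝ) : ℝ :=
  Real.sqrt (∑ i, ∑ j, (M i j) ^ 2)

/-- Distance (w.r.t. Frobenius norm) of a matrix to a set of matrices. -/
noncomputable def mdist {a b : ℕ} (X : Matrix (Fin a) (Fin b) ℝ)
    (Ω : Set (Matrix (Fin a) (Fin b) ℝ)) : ℝ :=
  sInf ((fun Y => frob (X - Y)) '' Ω)

theorem frob_nonneg {a b : ℕ} (M : Matrix (Fin a) (Fin b) ℝ) : 0 ≤ frob M :=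
  Real.sqrt_nonneg _

theorem frob_sq {a b : ℕ} (M : Matrix (Fin a) (Fin b) ℝ) :
    frob M ^ 2 = ∑ i, ∑ j, (M i j) ^ 2 :=
  Real.sq_sqrt (by positivity)

theorem mdist_nonneg {a b : ℕ} (X : Matrix (Fin a) (Fin b) ℝ)
    (Ω : Set (Matrix (Fin a) (Fin b) ℝ)) : 0 ≤ mdist X Ω :=
  Real.sInf_nonneg (by rintro _ ⟨Y, -, rfl⟩; exact frob_nonneg _)

theorem mdist_le_frob {a b : ℕ} (X : Matrix (Fin a) (Fin b) ℝ)
    {Ω : Set (Matrix (Fin a) (Fin b) ℝ)} {Y : Matrix (Fin a) (Fin b) ℝ} (hY : Y ∈ Ω) :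
    mdist X Ω ≤ frob (X - Y) :=
  csInf_le ⟨0, by rintro _ ⟨Y, -, rfl⟩; exact frob_nonneg _⟩ ⟨Y, hY, rfl⟩

/-- A uniform decrease of the squared distance to every point of a set is a decrease of the squared
distance to the set. -/
theorem mdist_sq_add_le {a b : ℕ} {X Z : Matrix (Fin a) (Fin b) ℝ}
    {Ω : Set (Matrix (Fin a) (Fin b) ℝ)} (hne : Ω.Nonempty) {c : ℝ}
    (h : ∀ Y ∈ Ω, frob (Z - Y) ^ 2 + c ≤ frob (X - Y) ^ 2) :
    mdist Z Ω ^ 2 + c ≤ mdist X Ω ^ 2 := by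
  have hle : Real.sqrt (mdist Z Ω ^ 2 + c) ≤ mdist X Ω := by
    refine le_csInf (hne.image _) ?_
    rintro _ ⟨Y, hY, rfl⟩
    refine Real.sqrt_le_iff.2 ⟨frob_nonneg _, le_trans ?_ (h Y hY)⟩
    have := pow_le_pow_left₀ (mdist_nonneg Z Ω) (mdist_le_frob Z hY) 2
    linarith
  exact (Real.sqrt_le_iff.1 hle).2

/-- The Pythagorean-type estimate for a relaxed block step, in a single column. -/
theorem sum_sq_block_step_le {ι κ : Type*} [Fintype κ] (A : ι → κ → ℝ) (τ : Finset ι)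
    (d : κ → ℝ) (r : ι → ℝ) {t : ℝ} (ht : 0 < t) (ha : 0 < ∑ i ∈ τ, ∑ j, A i j ^ 2)
    (hr : ∀ i ∈ τ, r i ^ 2 ≤ (∑ j, A i j * d j) * r i) :
    ∑ j, (d j - (t / ∑ i ∈ τ, ∑ j, A i j ^ 2) * ∑ i ∈ τ, A i j * r i) ^ 2 +
      2 * t * (1 - t / 2) / (∑ i ∈ τ, ∑ j, A i j ^ 2) * ∑ i ∈ τ, r i ^ 2 ≤ ∑ j, d j ^ 2 := by
  set a := ∑ i ∈ τ, ∑ j, A i j ^ 2 with ha'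
  have hinner : ∑ i ∈ τ, r i ^ 2 ≤ ∑ j, d j * ∑ i ∈ τ, A i j * r i := by
    refine (sum_le_sum hr).trans_eq ?_
    simp_rw [sum_mul, mul_sum]
    rw [sum_comm]
    exact sum_congr rfl fun j _ => sum_congr rfl fun i _ => by ring
  have hcs : ∑ j, (∑ i ∈ τ, A i j * r i) ^ 2 ≤ a * ∑ i ∈ τ, r i ^ 2 := by
    rw [ha', sum_comm, sum_mul]
    exact sum_le_sum fun j _ => sum_mul_sq_le_sq_mul_sq τ (fun i => A i j) r
  have hexp : ∑ j, (d j - (t / a) * ∑ i ∈ τ, A i j * r i) ^ 2 = ∑ j, d j ^ 2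
      - 2 * (t / a) * ∑ j, d j * ∑ i ∈ τ, A i j * r i
      + (t / a) ^ 2 * ∑ j, (∑ i ∈ τ, A i j * r i) ^ 2 := by
    rw [mul_sum _ _ (2 * (t / a)), mul_sum _ _ ((t / a) ^ 2), ← sum_sub_distrib,
      ← sum_add_distrib]
    exact sum_congr rfl fun j _ => by ring
  have h1 := mul_le_mul_of_nonneg_left hinner (show 0 ≤ 2 * (t / a) by positivity)
  have h2 := mul_le_mul_of_nonneg_left hcs (show 0 ≤ (t / a) ^ 2 by positivity)
  have h3 : 2 * t * (1 - t / 2) / a * ∑ i ∈ τ, r i ^ 2 =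
      2 * (t / a) * ∑ i ∈ τ, r i ^ 2 - (t / a) ^ 2 * (a * ∑ i ∈ τ, r i ^ 2) := by
    field_simp
  linarith

/-- A relaxed block step along a residual `R` decreases the squared distance to every `Y` for which
`A (X - Y)` dominates `R` on the block. -/
theorem frob_sq_block_step_le {m n p : ℕ} (A : Matrix (Fin m) (Fin n) ℝ) (τ : Finset (Fin m))
    (X Y Z : Matrix (Fin n) (Fin p) ℝ) (R : Matrix (Fin m) (Fin p) ℝ) {t : ℝ} (ht : 0 < t)
    (ha : 0 < ∑ i ∈ τ, ∑ j, A i j ^ 2)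
    (hZ : ∀ j q, Z j q = X j q - (t / ∑ i ∈ τ, ∑ j', A i j' ^ 2) * ∑ i ∈ τ, A i j * R i q)
    (hR : ∀ i ∈ τ, ∀ q, R i q ^ 2 ≤ (A * (X - Y)) i q * R i q) :
    frob (Z - Y) ^ 2 + 2 * t * (1 - t / 2) / (∑ i ∈ τ, ∑ j, A i j ^ 2) *
      ∑ i ∈ τ, ∑ q, R i q ^ 2 ≤ frob (X - Y) ^ 2 := by
  rw [frob_sq, frob_sq, sum_comm, sum_comm (s := τ) (f := fun i q => R i q ^ 2), mul_sum,
    ← sum_add_distrib, sum_comm (f := fun i j => (X - Y) i j ^ 2)]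
  refine sum_le_sum fun q _ => ?_
  refine le_trans (le_of_eq ?_) (sum_sq_block_step_le A τ (fun j => (X - Y) j q) (fun i => R i q)
    ht ha fun i hi => by simpa [Matrix.mul_apply] using hR i hi q)
  congr 1
  exact sum_congr rfl fun j _ => by simp only [Matrix.sub_apply, hZ]; ring

/-- Summing over the blocks of two partitions of complementary index sets is summing over all
indices. -/
theorem sum_blocks_union {ι : Type*} [Fintype ι] [DecidableEq ι] {S S' : Finset ι}
    (hdisj : Disjoint S S') (hunion : S ∪ S' = univ) {T T' : Finset (Finset ι)}
    (hT : (T : Set (Finset ι)).PairwiseDisjoint id) (hTu : T.sup id = S)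
    (hT' : (T' : Set (Finset ι)).PairwiseDisjoint id) (hT'u : T'.sup id = S')
    (f : ι → ℝ) : ∑ τ ∈ T ∪ T', ∑ i ∈ τ, f i = ∑ i, f i := by
  have hpd : ((T ∪ T' : Finset (Finset ι)) : Set (Finset ι)).PairwiseDisjoint id := by
    rw [coe_union]
    refine (Set.pairwiseDisjoint_union).2 ⟨hT, hT', fun σ hσ τ hτ _ => ?_⟩
    exact hdisj.mono (hTu ▸ le_sup (f := id) hσ) (hT'u ▸ le_sup (f := id) hτ)
  have hbu : (T ∪ T').biUnion id = univ := by
    rw [← sup_eq_biUnion, sup_union, hTu, hT'u, ← hunion, sup_eq_union]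
  rw [← hbu, sum_biUnion hpd]
  rfl

/-- One-step expected contraction of the B-MRK method (Theorem 3.2).
Blocks `τ ∈ T` partition the inequality rows and blocks `τ ∈ T'` partition the
equality rows; `∑ i ∈ τ, ∑ j, (A i j)^2 = ‖A_τ‖_F²`. -/
theorem bmrk_expected_contraction {m n p : ℕ}
    (A : Matrix (Fin m) (Fin n) ℝ) (B : Matrix (Fin m) (Fin p) ℝ)
    (Ile Ieq : Finset (Fin m)) (hdisj : Disjoint Ile Ieq)
    (hunion : Ile ∪ Ieq = Finset.univ)
    (Ω : Set (Matrix (Fin n) (Fin p) ℝ))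
    (hΩ : Ω = {X | (∀ i ∈ Ile, ∀ j, (A * X) i j ≤ B i j) ∧
                   (∀ i ∈ Ieq, ∀ j, (A * X) i j = B i j)})
    (hne : Ω.Nonempty)
    -- the partitions of the index sets into blocks
    (T T' : Finset (Finset (Fin m)))
    (hT : (T : Set (Finset (Fin m))).PairwiseDisjoint id)
    (hTu : T.sup id = Ile)
    (hT' : (T' : Set (Finset (Fin m))).PairwiseDisjoint id)
    (hT'u : T'.sup id = Ieq)
    (hTne : (T ∪ T').Nonempty)
    -- no zero block
    (hblock : ∀ τ ∈ T ∪ T', 0 < ∑ i ∈ τ, ∑ j, (A i j) ^ 2)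
    -- step sizes
    (t : Finset (Fin m) → ℝ) (ht : ∀ τ ∈ T ∪ T', 0 < t τ ∧ t τ < 2)
    -- Hoffman constant
    (L : ℝ) (hL : 0 < L)
    (hHoff : ∀ X : Matrix (Fin n) (Fin p) ℝ,
      mdist X Ω ≤ L * frob (Matrix.of fun i j =>
        if i ∈ Ile then max ((A * X - B) i j) 0 else (A * X - B) i j))
    -- the B-MRK updates
    (X : Matrix (Fin n) (Fin p) ℝ)
    (Xup : Finset (Fin m) → Matrix (Fin n) (Fin p) ℝ)
    (hXup : ∀ τ ∈ T, ∀ j q, Xup τ j q =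
      X j q - (t τ / ∑ i ∈ τ, ∑ j', (A i j') ^ 2) *
        ∑ i ∈ τ, A i j * max ((A * X - B) i q) 0)
    (hXup' : ∀ τ ∈ T', ∀ j q, Xup τ j q =
      X j q - (t τ / ∑ i ∈ τ, ∑ j', (A i j') ^ 2) *
        ∑ i ∈ τ, A i j * ((A * X - B) i q)) :
    ∑ τ ∈ T ∪ T', ((∑ i ∈ τ, ∑ j, (A i j) ^ 2) / frob A ^ 2) * mdist (Xup τ) Ω ^ 2
      ≤ (1 - ((T ∪ T').inf' hTne fun τ => 2 * t τ * (1 - t τ / 2)) /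
            (L ^ 2 * frob A ^ 2)) * mdist X Ω ^ 2 := by
  classical
  set C : Matrix (Fin m) (Fin p) ℝ := Matrix.of fun i j =>
    if i ∈ Ile then max ((A * X - B) i j) 0 else (A * X - B) i j with hC
  have hTsub : ∀ τ ∈ T, ∀ i ∈ τ, i ∈ Ile := fun τ hτ i hi =>
    (hTu ▸ le_sup (f := id) hτ : τ ≤ Ile) hi
  have hTsub' : ∀ τ ∈ T', ∀ i ∈ τ, i ∉ Ile := fun τ hτ i hi hi' =>
    disjoint_left.1 hdisj hi' ((hT'u ▸ le_sup (f := id) hτ : τ ≤ Ieq) hi)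
  have hstep : ∀ τ ∈ T ∪ T', ∀ j q, Xup τ j q =
      X j q - (t τ / ∑ i ∈ τ, ∑ j', A i j' ^ 2) * ∑ i ∈ τ, A i j * C i q := by
    intro τ hτ j q
    rcases mem_union.1 hτ with h | h
    · rw [hXup τ h]
      congr 2
      exact sum_congr rfl fun i hi => by simp [hC, hTsub τ h i hi]
    · rw [hXup' τ h]
      congr 2
      exact sum_congr rfl fun i hi => by simp [hC, hTsub' τ h i hi]
  have hdom : ∀ Y ∈ Ω, ∀ i q, C i q ^ 2 ≤ (A * (X - Y)) i q * C i q := by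
    intro Y hY i q
    rw [hΩ] at hY
    rw [Matrix.mul_sub, Matrix.sub_apply]
    by_cases hi : i ∈ Ile
    · have hYi := hY.1 i hi q
      have hCi : C i q = max ((A * X) i q - B i q) 0 := by simp [hC, hi]
      rw [hCi]
      rcases le_total ((A * X) i q - B i q) 0 with h | h
      · simp [max_eq_right h]
      · rw [max_eq_left h, sq]
        exact mul_le_mul_of_nonneg_right (by linarith) h
    · have hieq : i ∈ Ieq := (mem_union.1 (hunion ▸ mem_univ i)).resolve_left hi
      have hCi : C i q = (A * X) i q - B i q := by simp [hC, hi]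
      rw [hCi, hY.2 i hieq q, sq]
  set μ := (T ∪ T').inf' hTne fun τ => 2 * t τ * (1 - t τ / 2)
  have hμpos : 0 < μ := (lt_inf'_iff _).2 fun τ hτ =>
    mul_pos (by linarith [(ht τ hτ).1]) (by linarith [(ht τ hτ).2])
  have hblk : ∀ τ ∈ T ∪ T', (∑ i ∈ τ, ∑ j, A i j ^ 2) * mdist (Xup τ) Ω ^ 2 +
      μ * ∑ i ∈ τ, ∑ q, C i q ^ 2 ≤ (∑ i ∈ τ, ∑ j, A i j ^ 2) * mdist X Ω ^ 2 := by
    intro τ hτ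
    have ha := hblock τ hτ
    have hμτ : μ ≤ 2 * t τ * (1 - t τ / 2) := inf'_le _ hτ
    have hr : 0 ≤ ∑ i ∈ τ, ∑ q, C i q ^ 2 := by positivity
    have hdec := mdist_sq_add_le hne fun Y hY =>
      frob_sq_block_step_le A τ X Y (Xup τ) C (ht τ hτ).1 ha (hstep τ hτ)
        fun i _ q => hdom Y hY i q
    have hmul := mul_le_mul_of_nonneg_left hdec ha.le
    rw [mul_add, ← mul_assoc _ (_ / _), mul_div_cancel₀ _ ha.ne'] at hmul
    linarith [mul_le_mul_of_nonneg_right hμτ hr]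
  have hA : ∑ τ ∈ T ∪ T', ∑ i ∈ τ, ∑ j, A i j ^ 2 = frob A ^ 2 :=
    (sum_blocks_union hdisj hunion hT hTu hT' hT'u _).trans (frob_sq A).symm
  have hCsum : ∑ τ ∈ T ∪ T', ∑ i ∈ τ, ∑ q, C i q ^ 2 = frob C ^ 2 :=
    (sum_blocks_union hdisj hunion hT hTu hT' hT'u _).trans (frob_sq C).symm
  have hApos : 0 < frob A ^ 2 := hA ▸ sum_pos hblock hTne
  have htotal := sum_le_sum hblk
  rw [sum_add_distrib, ← mul_sum, ← sum_mul, hA, hCsum] at htotal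
  have hH : mdist X Ω ^ 2 ≤ L ^ 2 * frob C ^ 2 := by
    rw [← mul_pow]
    exact pow_le_pow_left₀ (mdist_nonneg X Ω) (hHoff X) 2
  have hH' : μ * (mdist X Ω ^ 2 / L ^ 2) ≤ μ * frob C ^ 2 :=
    mul_le_mul_of_nonneg_left ((div_le_iff₀' (by positivity)).2 hH) hμpos.le
  simp_rw [div_mul_eq_mul_div]
  rw [← sum_div, div_le_iff₀ hApos]
  have hrhs : (1 - μ / (L ^ 2 * frob A ^ 2)) * mdist X Ω ^ 2 * frob A ^ 2 =
      frob A ^ 2 * mdist X Ω ^ 2 - μ * (mdist X Ω ^ 2 / L ^ 2) := by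
    have hA0 : frob A ≠ 0 := pow_ne_zero_iff two_ne_zero |>.1 hApos.ne'
    field_simp
  linarith
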